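/- arXiv:2601.09872 — 3 statements merged into one kernel-verified Lean document; each statement's English description precedes it below -/
import Mathlib

section
/- Let T > 0, α_m, α_c > 0, σ_z > 0, and let β : ℝ → ℝ. Set A = diag(0, −α_m, −α_c), Q = diag(0, σ_m², σ_c²), C(t) = (β(t), γ_F, γ_C), R = σ_z². Suppose Σ : ℝ → Matrix (Fin 3) (Fin 3) ℝ is differentiable on [0,T], Σ(t) is symmetric for every t ∈ [0,T], and Σ satisfies the Riccati equation Σ'(t) = A Σ(t) + Σ(t) Aᵀ + Q − Σ(t) C(t)ᵀ R⁻¹ C(t) Σ(t). Then the (1,1) entry satisfies (Σ(t)₁₁)' = −(1/σ_z²) · (β(t) Σ₁₁(t) + γ_F Σ₁₂(t) + γ_C Σ₁₃(t))² ≤ 0 for all t ∈ [0,T]; consequently t ↦ Σ₁₁(t) is antitone (non-increasing) on [0,T], and in particular Σ₁₁(t) ≤ Σ₁₁(0) for all t ∈ [0,T]. -/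
open Matrix Set

attribute [local instance] Matrix.normedAddCommGroup Matrix.normedSpace

/-- Right-hand side of the matrix Riccati equation
`Σ' = AΣ + ΣAᵀ + Q − Σ Cᵀ R⁻¹ C Σ` of the Kalman–Bucy filter. -/
noncomputable def riccatiRHS (A Q : Matrix (Fin 3) (Fin 3) ℝ)
    (C : Matrix (Fin 1) (Fin 3) ℝ) (R : ℝ) (S : Matrix (Fin 3) (Fin 3) ℝ) :
    Matrix (Fin 3) (Fin 3) ℝ :=
  A * S + S * Aᵀ + Q - R⁻¹ • (S * Cᵀ * C * S)

/-- Price discovery: for a symmetric solution of the covariance Riccati system,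
the posterior variance `Σ₁₁(t) = Var(v − P_t | ℱ_t^Y)` has derivative
`−(1/σ_z²)(β Σ₁₁ + γ_F Σ₁₂ + γ_C Σ₁₃)² ≤ 0`, hence is non-increasing on `[0,T]`
and in particular bounded by its initial value. -/
theorem sigma_vv_antitone (T : ℝ) (hT : 0 < T)
    (αm αc σz : ℝ) (hαm : 0 < αm) (hαc : 0 < αc) (hσz : 0 < σz)
    (σm σc γF γC : ℝ) (β : ℝ → ℝ)
    (S : ℝ → Matrix (Fin 3) (Fin 3) ℝ)
    (hsymm : ∀ t ∈ Icc (0 : ℝ) T, (S t).IsSymm)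
    (hS : ∀ t ∈ Icc (0 : ℝ) T,
      HasDerivAt S
        (riccatiRHS (Matrix.diagonal ![0, -αm, -αc]) (Matrix.diagonal ![0, σm ^ 2, σc ^ 2])
          (Matrix.of ![![β t, γF, γC]]) (σz ^ 2) (S t)) t) :
    (∀ t ∈ Icc (0 : ℝ) T,
      HasDerivAt (fun s => S s 0 0)
        (-(1 / σz ^ 2) * (β t * S t 0 0 + γF * S t 0 1 + γC * S t 0 2) ^ 2) t ∧
      -(1 / σz ^ 2) * (β t * S t 0 0 + γF * S t 0 1 + γC * S t 0 2) ^ 2 ≤ 0) ∧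
    AntitoneOn (fun t => S t 0 0) (Icc (0 : ℝ) T) ∧
    ∀ t ∈ Icc (0 : ℝ) T, S t 0 0 ≤ S 0 0 0 := by
  have hderiv : ∀ t ∈ Icc (0 : ℝ) T,
      HasDerivAt (fun s => S s 0 0)
        (-(1 / σz ^ 2) * (β t * S t 0 0 + γF * S t 0 1 + γC * S t 0 2) ^ 2) t := by
    intro t ht
    have h := hasDerivAt_pi.1 (hasDerivAt_pi.1 (hS t ht) 0) 0
    have h1 : S t 1 0 = S t 0 1 := (hsymm t ht).apply 0 1
    have h2 : S t 2 0 = S t 0 2 := (hsymm t ht).apply 0 2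
    refine HasDerivAt.congr_deriv h ?_
    simp [riccatiRHS, Matrix.mul_apply, Fin.sum_univ_three, Matrix.diagonal_apply, h1, h2]
    exact Or.inl (by ring)
  have hnonpos : ∀ t : ℝ,
      -(1 / σz ^ 2) * (β t * S t 0 0 + γF * S t 0 1 + γC * S t 0 2) ^ 2 ≤ 0 := fun t =>
    mul_nonpos_of_nonpos_of_nonneg (neg_nonpos.2 (by positivity)) (sq_nonneg _)
  have hanti : AntitoneOn (fun t => S t 0 0) (Icc (0 : ℝ) T) :=
    antitoneOn_of_hasDerivWithinAt_nonpos (convex_Icc 0 T)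
      (fun t ht => (hderiv t ht).continuousAt.continuousWithinAt)
      (fun t ht => (hderiv t (interior_subset ht)).hasDerivWithinAt)
      (fun t _ => hnonpos t)
  exact ⟨fun t ht => ⟨hderiv t ht, hnonpos t⟩, hanti,
    fun t ht => hanti (left_mem_Icc.2 hT.le) ht ht.1⟩
end

section
/- Let T > 0, α_m, α_c > 0, σ_z > 0, σ_m, σ_c ∈ ℝ. Set A = diag(0, −α_m, −α_c), Q = diag(0, σ_m², σ_c²), C(t) = (β(t), γ_F, γ_C), R = σ_z². Suppose Σ : ℝ → Matrix (Fin 3) (Fin 3) ℝ is differentiable on [0,T], Σ(t) is symmetric for every t ∈ [0,T], Σ₂₂(0) ≥ 0, and Σ satisfies the Riccati equation Σ'(t) = A Σ(t) + Σ(t) Aᵀ + Q − Σ(t) C(t)ᵀ R⁻¹ C(t) Σ(t). Then the (2,2) entry satisfies (Σ₂₂)'(t) ≤ −2α_m Σ₂₂(t) + σ_m² for all t ∈ [0,T], and consequently Σ₂₂(t) ≤ e^{−2α_m t} Σ₂₂(0) + (σ_m²/(2α_m)) (1 − e^{−2α_m t}) for all t ∈ [0,T]. -/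
open Matrix Set

attribute [local instance] Matrix.normedAddCommGroup Matrix.normedSpace

lemma riccatiRHS_diagonal_apply_self_le (a q : Fin 3 → ℝ) (C : Matrix (Fin 1) (Fin 3) ℝ)
    {R : ℝ} (hR : 0 ≤ R) {S : Matrix (Fin 3) (Fin 3) ℝ} (hS : S.IsSymm) (i : Fin 3) :
    riccatiRHS (diagonal a) (diagonal q) C R S i i ≤ 2 * a i * S i i + q i := by
  have hgain : 0 ≤ (S * Cᵀ * C * S) i i := by
    have h : S * Cᵀ * C * S = (S * Cᵀ) * (S * Cᵀ)ᵀ := by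
      rw [transpose_mul, transpose_transpose, hS.eq, Matrix.mul_assoc (S * Cᵀ)]
    rw [h, mul_apply]
    exact Finset.sum_nonneg fun j _ => mul_self_nonneg _
  have hquad := mul_nonneg (inv_nonneg.2 hR) hgain
  simp only [riccatiRHS, Matrix.sub_apply, Matrix.add_apply, Matrix.smul_apply,
    diagonal_transpose, diagonal_mul, mul_diagonal, diagonal_apply_eq, smul_eq_mul]
  linarith

lemma HasDerivAt.matrix_apply {m n : Type*} [Fintype m] [Fintype n] {S : ℝ → Matrix m n ℝ}
    {S' : Matrix m n ℝ} {t : ℝ} (h : HasDerivAt S S' t) (i : m) (j : n) :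
    HasDerivAt (fun s => S s i j) (S' i j) t :=
  hasDerivAt_pi.1 (hasDerivAt_pi.1 h i) j

/-- Grönwall's inequality for the scalar differential inequality `f' ≤ -a f + b` with `a ≠ 0`. -/
lemma le_exp_mul_add_of_deriv_le {f f' : ℝ → ℝ} {a b T : ℝ} (ha : a ≠ 0)
    (hf : ∀ t ∈ Icc 0 T, HasDerivAt f (f' t) t) (hle : ∀ t ∈ Icc 0 T, f' t ≤ -a * f t + b)
    {t : ℝ} (ht : t ∈ Icc 0 T) :
    f t ≤ Real.exp (-a * t) * f 0 + b / a * (1 - Real.exp (-a * t)) := by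
  have hderiv : ∀ s ∈ Icc 0 T, HasDerivAt (fun s => Real.exp (a * s) * (f s - b / a))
      (Real.exp (a * s) * (f' s + a * f s - b)) s := fun s hs => by
    have hexp : HasDerivAt (fun s => Real.exp (a * s)) (Real.exp (a * s) * a) s := by
      simpa using ((hasDerivAt_id s).const_mul a).exp
    refine (hexp.mul ((hf s hs).sub_const (b / a))).congr_deriv ?_
    field_simp
    ring
  have hanti : AntitoneOn (fun s => Real.exp (a * s) * (f s - b / a)) (Icc 0 T) := by
    refine antitoneOn_of_hasDerivWithinAt_nonpos (convex_Icc 0 T)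
      (fun s hs => (hderiv s hs).continuousAt.continuousWithinAt)
      (fun s hs => (hderiv s (interior_subset hs)).hasDerivWithinAt) fun s hs => ?_
    exact mul_nonpos_of_nonneg_of_nonpos (Real.exp_pos _).le
      (by linarith [hle s (interior_subset hs)])
  have h := hanti (left_mem_Icc.2 (ht.1.trans ht.2)) ht ht.1
  simp only [mul_zero, Real.exp_zero, one_mul] at h
  have hmul := mul_le_mul_of_nonneg_left h (Real.exp_pos (-a * t)).le
  rw [← mul_assoc, ← Real.exp_add, neg_mul, neg_add_cancel, Real.exp_zero, one_mul,
    ← neg_mul] at hmul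
  linarith

/-- No-blow-up estimate for the momentum variance: for a symmetric solution of
the covariance Riccati system, the `(2,2)` entry satisfies
`(Σ₂₂)' ≤ −2α_m Σ₂₂ + σ_m²` and hence the Grönwall bound
`Σ₂₂(t) ≤ e^{−2α_m t} Σ₂₂(0) + (σ_m²/(2α_m))(1 − e^{−2α_m t})` on `[0,T]`. -/
theorem sigma_mm_bound (T : ℝ) (hT : 0 < T)
    (αm αc σz : ℝ) (hαm : 0 < αm) (hαc : 0 < αc) (hσz : 0 < σz)
    (σm σc γF γC : ℝ) (β : ℝ → ℝ)
    (S : ℝ → Matrix (Fin 3) (Fin 3) ℝ)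
    (hsymm : ∀ t ∈ Icc (0 : ℝ) T, (S t).IsSymm)
    (h0 : 0 ≤ S 0 1 1)
    (hS : ∀ t ∈ Icc (0 : ℝ) T,
      HasDerivAt S
        (riccatiRHS (Matrix.diagonal ![0, -αm, -αc]) (Matrix.diagonal ![0, σm ^ 2, σc ^ 2])
          (Matrix.of ![![β t, γF, γC]]) (σz ^ 2) (S t)) t) :
    (∀ t ∈ Icc (0 : ℝ) T,
      HasDerivAt (fun s => S s 1 1)
        (riccatiRHS (Matrix.diagonal ![0, -αm, -αc]) (Matrix.diagonal ![0, σm ^ 2, σc ^ 2])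
          (Matrix.of ![![β t, γF, γC]]) (σz ^ 2) (S t) 1 1) t ∧
      riccatiRHS (Matrix.diagonal ![0, -αm, -αc]) (Matrix.diagonal ![0, σm ^ 2, σc ^ 2])
          (Matrix.of ![![β t, γF, γC]]) (σz ^ 2) (S t) 1 1
        ≤ -2 * αm * S t 1 1 + σm ^ 2) ∧
    ∀ t ∈ Icc (0 : ℝ) T,
      S t 1 1 ≤ Real.exp (-2 * αm * t) * S 0 1 1
        + σm ^ 2 / (2 * αm) * (1 - Real.exp (-2 * αm * t)) := by
  have hderiv := fun t ht => (hS t ht).matrix_apply 1 1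
  have hle := fun t ht => (riccatiRHS_diagonal_apply_self_le ![0, -αm, -αc] ![0, σm ^ 2, σc ^ 2]
    (Matrix.of ![![β t, γF, γC]]) (sq_nonneg σz) (hsymm t ht) 1).trans_eq
      (show _ = -2 * αm * S t 1 1 + σm ^ 2 by simp)
  refine ⟨fun t ht => ⟨hderiv t ht, hle t ht⟩, fun t ht => ?_⟩
  have h := le_exp_mul_add_of_deriv_le (a := 2 * αm) (b := σm ^ 2) (by positivity) hderiv
    (fun s hs => (hle s hs).trans_eq (by ring)) ht
  simpa only [neg_mul] using h
end

section
/- Let T > 0 and let Σ : ℝ → Matrix (Fin 3) (Fin 3) ℝ be differentiable on [0,T] with Σ(t) symmetric positive semidefinite for every t ∈ [0,T], satisfying the matrix Riccati equation Σ'(t) = A Σ(t) + Σ(t) Aᵀ + Q − Σ(t) C(t)ᵀ R⁻¹ C(t) Σ(t) on [0,T], where A, Q are real 3×3 matrices with Q symmetric positive semidefinite, C(t) is a 1×3 row vector for each t, and R > 0 is a scalar. Let ‖A‖ denote the operator norm of A (as a linear map on Euclidean ℝ³). Then for all t ∈ [0,T], trace(Σ(t)) ≤ e^{2‖A‖ t}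 · (trace(Σ(0)) + t · trace(Q)). In particular, Σ remains bounded on [0,T] and no finite-time blow-up occurs. -/
open Matrix Set

attribute [local instance] Matrix.normedAddCommGroup Matrix.normedSpace

/-- Operator norm of a real `3×3` matrix, viewed as a linear map on Euclidean `ℝ³`. -/
noncomputable def euclideanOpNorm (A : Matrix (Fin 3) (Fin 3) ℝ) : ℝ :=
  ‖LinearMap.toContinuousLinearMap (Matrix.toEuclideanLin A)‖

/-- A quadratic form is bounded by the operator norm times the squared Euclidean norm. -/
theorem dotProduct_mulVec_le_euclideanOpNorm (A : Matrix (Fin 3) (Fin 3) ℝ) (v : Fin 3 → ℝ) :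
    v ⬝ᵥ A *ᵥ v ≤ euclideanOpNorm A * (v ⬝ᵥ v) := by
  set x : EuclideanSpace ℝ (Fin 3) := WithLp.toLp 2 v
  have hsq : v ⬝ᵥ v = ‖x‖ * ‖x‖ := by
    rw [← real_inner_self_eq_norm_mul_norm, EuclideanSpace.inner_eq_star_dotProduct]
    simp [x]
  have hAx : ‖toEuclideanCLM (𝕜 := ℝ) A x‖ ≤ euclideanOpNorm A * ‖x‖ :=
    (toEuclideanCLM (𝕜 := ℝ) A).le_opNorm x
  calc v ⬝ᵥ A *ᵥ v = inner ℝ x (toEuclideanCLM (𝕜 := ℝ) A x) :=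
        (inner_toEuclideanCLM A x x).symm
    _ ≤ ‖x‖ * ‖toEuclideanCLM (𝕜 := ℝ) A x‖ := real_inner_le_norm _ _
    _ ≤ ‖x‖ * (euclideanOpNorm A * ‖x‖) := by gcongr
    _ = euclideanOpNorm A * (v ⬝ᵥ v) := by rw [hsq]; ring

theorem trace_mul_le_euclideanOpNorm_mul_trace (A : Matrix (Fin 3) (Fin 3) ℝ)
    {S : Matrix (Fin 3) (Fin 3) ℝ} (hS : S.PosSemidef) :
    (A * S).trace ≤ euclideanOpNorm A * S.trace := by
  obtain ⟨m, v, rfl⟩ := posSemidef_iff_eq_sum_vecMulVec.mp hS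
  simp only [trace_sum, mul_vecMulVec, trace_vecMulVec, star_trivial, Finset.mul_sum]
  refine Finset.sum_le_sum fun i _ => ?_
  rw [dotProduct_comm]
  exact dotProduct_mulVec_le_euclideanOpNorm A (v i)

theorem trace_riccatiRHS_le (A Q : Matrix (Fin 3) (Fin 3) ℝ) (C : Matrix (Fin 1) (Fin 3) ℝ)
    {R : ℝ} (hR : 0 < R) {S : Matrix (Fin 3) (Fin 3) ℝ} (hS : S.PosSemidef) :
    (riccatiRHS A Q C R S).trace ≤ 2 * euclideanOpNorm A * S.trace + Q.trace := by
  have hSt : Sᵀ = S := by simpa using hS.isHermitian.eq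
  have hdrift := trace_mul_le_euclideanOpNorm_mul_trace A hS
  have hdrift_transpose : (S * Aᵀ).trace = (A * S).trace := by
    rw [← trace_transpose, transpose_mul, transpose_transpose, hSt]
  have hquad : 0 ≤ (S * Cᵀ * C * S).trace := by
    have h := (posSemidef_conjTranspose_mul_self (C * S)).trace_nonneg
    simpa [conjTranspose_eq_transpose_of_trivial, transpose_mul, hSt, Matrix.mul_assoc] using h
  have hgain : 0 ≤ R⁻¹ * (S * Cᵀ * C * S).trace := by positivity
  simp only [riccatiRHS, trace_sub, trace_add, trace_smul, smul_eq_mul, hdrift_transpose]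
  linarith

theorem HasDerivAt.matrix_trace {S : ℝ → Matrix (Fin 3) (Fin 3) ℝ}
    {S' : Matrix (Fin 3) (Fin 3) ℝ} {t : ℝ} (h : HasDerivAt S S' t) :
    HasDerivAt (fun s => (S s).trace) S'.trace t :=
  (LinearMap.toContinuousLinearMap (traceLinearMap (Fin 3) ℝ ℝ)).hasFDerivAt.comp_hasDerivAt t h

/-- Grönwall's inequality in the form `f t ≤ exp (k * t) * (f 0 + t * q)`. -/
theorem le_exp_mul_add_of_hasDerivAt_le {f f' : ℝ → ℝ} {k q T : ℝ} (hk : 0 ≤ k) (hq : 0 ≤ q)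
    (hf : ∀ t ∈ Icc (0 : ℝ) T, HasDerivAt f (f' t) t)
    (hf' : ∀ t ∈ Icc (0 : ℝ) T, f' t ≤ k * f t + q) :
    ∀ t ∈ Icc (0 : ℝ) T, f t ≤ Real.exp (k * t) * (f 0 + t * q) := by
  have hg : ∀ t ∈ Icc (0 : ℝ) T, HasDerivAt (fun s => Real.exp (-(k * s)) * f s - s * q)
      (Real.exp (-(k * t)) * (f' t - k * f t) - q) t := by
    intro t ht
    have hexp : HasDerivAt (fun s => Real.exp (-(k * s))) (Real.exp (-(k * t)) * -(k * 1)) t :=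
      ((hasDerivAt_id t).const_mul k).neg.exp
    refine ((hexp.mul (hf t ht)).sub ((hasDerivAt_id t).mul_const q)).congr_deriv ?_
    ring
  have hanti : AntitoneOn (fun s => Real.exp (-(k * s)) * f s - s * q) (Icc 0 T) := by
    refine antitoneOn_of_deriv_nonpos (convex_Icc 0 T)
      (fun t ht => (hg t ht).continuousAt.continuousWithinAt)
      (fun t ht => (hg t (interior_subset ht)).differentiableAt.differentiableWithinAt) ?_
    intro t ht
    have ht := interior_subset ht
    rw [(hg t ht).deriv]
    have hexp_le : Real.exp (-(k * t)) ≤ 1 :=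
      Real.exp_le_one_iff.mpr (neg_nonpos.mpr (mul_nonneg hk ht.1))
    have hrate : Real.exp (-(k * t)) * (f' t - k * f t) ≤ Real.exp (-(k * t)) * q := by
      gcongr
      linarith [hf' t ht]
    linarith [mul_le_mul_of_nonneg_right hexp_le hq]
  intro t ht
  have h := hanti ⟨le_rfl, ht.1.trans ht.2⟩ ht ht.1
  simp only [mul_zero, neg_zero, Real.exp_zero, one_mul, zero_mul, sub_zero] at h
  calc f t = Real.exp (k * t) * (Real.exp (-(k * t)) * f t) := by
        rw [← mul_assoc, ← Real.exp_add]
        simp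
    _ ≤ Real.exp (k * t) * (f 0 + t * q) := by
        gcongr
        linarith

/-- Grönwall-type a priori trace bound (global existence / no finite-time blow-up):
a positive-semidefinite solution of the matrix Riccati equation with `Q ⪰ 0` and
`R > 0` satisfies `trace Σ(t) ≤ e^{2‖A‖t}(trace Σ(0) + t · trace Q)` on `[0,T]`. -/
theorem riccati_trace_bound (T : ℝ) (hT : 0 < T)
    (A Q : Matrix (Fin 3) (Fin 3) ℝ) (hQ : Q.PosSemidef)
    (C : ℝ → Matrix (Fin 1) (Fin 3) ℝ) (R : ℝ) (hR : 0 < R)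
    (S : ℝ → Matrix (Fin 3) (Fin 3) ℝ)
    (hpsd : ∀ t ∈ Icc (0 : ℝ) T, (S t).PosSemidef)
    (hS : ∀ t ∈ Icc (0 : ℝ) T, HasDerivAt S (riccatiRHS A Q (C t) R (S t)) t) :
    ∀ t ∈ Icc (0 : ℝ) T,
      (S t).trace ≤ Real.exp (2 * euclideanOpNorm A * t) * ((S 0).trace + t * Q.trace) := by
  exact le_exp_mul_add_of_hasDerivAt_le (mul_nonneg zero_le_two (norm_nonneg _))
    hQ.trace_nonneg (fun t ht => (hS t ht).matrix_trace)
    (fun t ht => trace_riccatiRHS_le A Q (C t) hR (hpsd t ht))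
end
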